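/- Let r ≥ 1 be an integer, let A and B be arbitrary complex numbers, and let h > 1 be real. Then lim_{n→∞} ∑_{k=0}^{n} C_k(n,h) · exp( A·(−(1 − 2k/n)²)^r + B·(−(1 − 2k/n)²)^{2r} ) = exp( A·(−h²)^r + B·(−h²)^{2r} ). (Taking A = −iβx/(2γ) and B = i/(4γ) for real x, β, γ with γ ≠ 0, this gives the persistence in time of superoscillations for the Schrödinger equation with quadratic Hamiltonian and superoscillating initial data of even power type p = 2r.) -/

import Mathlib

open Complex Filter Finset

/-- The superoscillation coefficients `C_k(n,h)`. -/
noncomputable def supC (n k : ℕ) (h : ℝ) : ℝ :=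
  (n.choose k : ℝ) * ((1 + h) / 2) ^ (n - k) * ((1 - h) / 2) ^ k

open Topology

/-- The moment `∑ₖ (n choose k) p ^ (n - k) q ^ k (k + a) ^ m` of the complex binomial weights,
shifted by `a`. -/
noncomputable def binomialMoment (p q : ℂ) (n a m : ℕ) : ℂ :=
  ∑ k ∈ Finset.range (n + 1), (n.choose k : ℂ) * p ^ (n - k) * q ^ k * ((k : ℂ) + a) ^ m

theorem binomialMoment_zero_right {p q : ℂ} (hpq : p + q = 1) (n a : ℕ) :
    binomialMoment p q n a 0 = 1 := by
  have h := add_pow q p n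
  rw [add_comm q p, hpq, one_pow] at h
  rw [h]
  exact Finset.sum_congr rfl fun k _ => by ring

theorem binomialMoment_zero_left (p q : ℂ) (a m : ℕ) :
    binomialMoment p q 0 a m = (a : ℂ) ^ m := by
  simp [binomialMoment]

theorem binomialMoment_succ_succ (p q : ℂ) (n a m : ℕ) :
    binomialMoment p q (n + 1) a (m + 1) =
      a * binomialMoment p q (n + 1) a m + (n + 1) * q * binomialMoment p q n (a + 1) m := by
  have hk : ∑ k ∈ Finset.range (n + 1 + 1), (k : ℂ) *
      (((n + 1).choose k : ℂ) * p ^ (n + 1 - k) * q ^ k * ((k : ℂ) + a) ^ m) =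
      (n + 1) * q * binomialMoment p q n (a + 1) m := by
    rw [Finset.sum_range_succ', binomialMoment, Finset.mul_sum]
    simp only [Nat.cast_zero, zero_mul, add_zero]
    refine Finset.sum_congr rfl fun k _ => ?_
    have hc : ((n : ℂ) + 1) * n.choose k = (n + 1).choose (k + 1) * (k + 1) := by
      exact_mod_cast Nat.add_one_mul_choose_eq n k
    rw [Nat.add_sub_add_right]
    push_cast
    linear_combination (-(p ^ (n - k) * q ^ (k + 1) * ((k : ℂ) + 1 + a) ^ m)) * hc
  rw [← hk, binomialMoment, binomialMoment, Finset.mul_sum, ← Finset.sum_add_distrib]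
  exact Finset.sum_congr rfl fun k _ => by ring

theorem norm_binomialMoment_le {p q : ℂ} (hpq : p + q = 1) {R : ℝ} (hR : 1 ≤ R) (hq : ‖q‖ ≤ R)
    (n a m : ℕ) : ‖binomialMoment p q n a m‖ ≤ (R * (n + a)) ^ m := by
  induction m generalizing n a with
  | zero => simp [binomialMoment_zero_right hpq]
  | succ m ih =>
    cases n with
    | zero =>
      rw [binomialMoment_zero_left, norm_pow, Complex.norm_natCast]
      gcongr
      simpa using le_mul_of_one_le_left a.cast_nonneg hR
    | succ n =>
      have h₁ := ih (n + 1) a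
      have h₂ := ih n (a + 1)
      have e : (n : ℝ) + ((a + 1 : ℕ) : ℝ) = ((n + 1 : ℕ) : ℝ) + a := by push_cast; ring
      rw [e] at h₂
      set C := (R * (((n + 1 : ℕ) : ℝ) + a)) ^ m with hC
      have hn : ‖(n : ℂ) + 1‖ = n + 1 := by exact_mod_cast Complex.norm_natCast (n + 1)
      rw [binomialMoment_succ_succ]
      calc _ ≤ ‖(a : ℂ) * binomialMoment p q (n + 1) a m‖ +
              ‖((n : ℂ) + 1) * q * binomialMoment p q n (a + 1) m‖ := norm_add_le _ _
        _ ≤ (R * a) * C + ((n + 1) * R) * C := by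
            rw [norm_mul, norm_mul, norm_mul, hn, Complex.norm_natCast]
            have : (a : ℝ) ≤ R * a := le_mul_of_one_le_left a.cast_nonneg hR
            gcongr
        _ = _ := by rw [pow_succ, ← hC]; push_cast; ring

theorem tendsto_binomialMoment_div_pow {p q : ℂ} (hpq : p + q = 1) (a m : ℕ) :
    Tendsto (fun n : ℕ => binomialMoment p q n a m / (n : ℂ) ^ m) atTop (𝓝 (q ^ m)) := by
  induction m generalizing a with
  | zero => simp [binomialMoment_zero_right hpq]
  | succ m ih =>
    rw [← tendsto_add_atTop_iff_nat 1]
    have h₁ := (tendsto_add_atTop_iff_nat 1).2 (ih a)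
    have hinv : Tendsto (fun n : ℕ => (a : ℂ) / ((n + 1 : ℕ) : ℂ)) atTop (𝓝 0) :=
      (tendsto_add_atTop_iff_nat 1).2 (tendsto_const_div_atTop_nhds_zero_nat (a : ℂ))
    have hratio : Tendsto (fun n : ℕ => ((n : ℂ) / ((n : ℂ) + 1)) ^ m) atTop (𝓝 1) := by
      simpa using (tendsto_natCast_div_add_atTop (1 : ℂ)).pow m
    have h := (hinv.mul h₁).add (((ih (a + 1)).mul hratio).const_mul q)
    have e : 0 * q ^ m + q * (q ^ m * 1) = q ^ (m + 1) := by ring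
    rw [e] at h
    refine h.congr' ?_
    filter_upwards [eventually_gt_atTop 0] with n hn
    have hn : (n : ℂ) ≠ 0 := by exact_mod_cast hn.ne'
    have hn' : (n : ℂ) + 1 ≠ 0 := by exact_mod_cast n.succ_ne_zero
    rw [binomialMoment_succ_succ]
    push_cast
    rw [div_pow]
    field_simp
    ring

/-- Bernstein polynomials of an entire function converge pointwise on all of `ℂ`. -/
theorem tendsto_bernstein_of_entire {f : ℂ → ℂ} (hf : Differentiable ℂ f) {p q : ℂ}
    (hpq : p + q = 1) :
    Tendsto (fun n : ℕ => ∑ k ∈ Finset.range (n + 1),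
      (n.choose k : ℂ) * p ^ (n - k) * q ^ k * f (k / n)) atTop (𝓝 (f q)) := by
  obtain ⟨c, hs⟩ : ∃ c : ℕ → ℂ, ∀ z, HasSum (fun m => c m * z ^ m) (f z) := by
    refine ⟨fun m => (m.factorial : ℂ)⁻¹ * iteratedDeriv m f 0, fun z => ?_⟩
    refine Eq.subst (motive := fun g : ℕ → ℂ => HasSum g (f z)) (funext fun m => ?_)
      (Complex.hasSum_taylorSeries_of_entire hf 0 z)
    simp only [sub_zero, smul_eq_mul]
    ring
  obtain ⟨R, hR, hq⟩ : ∃ R : ℝ, 1 ≤ R ∧ ‖q‖ ≤ R := ⟨max 1 ‖q‖, le_max_left _ _, le_max_right _ _⟩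
  have hsum (n : ℕ) : ∑ k ∈ Finset.range (n + 1),
      (n.choose k : ℂ) * p ^ (n - k) * q ^ k * f (k / n) =
      ∑' m, c m * (binomialMoment p q n 0 m / (n : ℂ) ^ m) := by
    refine (HasSum.tsum_eq ?_).symm
    refine Eq.subst (motive := fun g : ℕ → ℂ => HasSum g _) (funext fun m => ?_)
      (hasSum_sum fun k (_ : k ∈ Finset.range (n + 1)) =>
        (hs (k / n)).mul_left ((n.choose k : ℂ) * p ^ (n - k) * q ^ k))
    rw [binomialMoment, Finset.sum_div, Finset.mul_sum]
    refine Finset.sum_congr rfl fun k _ => ?_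
    rw [Nat.cast_zero, add_zero, div_pow]
    ring
  simp only [hsum]
  rw [← (hs q).tsum_eq]
  refine tendsto_tsum_of_dominated_convergence (hs R).summable.norm
    (fun m => (tendsto_binomialMoment_div_pow hpq 0 m).const_mul (c m)) ?_
  filter_upwards [eventually_gt_atTop 0] with n hn m
  have hn : (0 : ℝ) < n := by exact_mod_cast hn
  rw [norm_mul, norm_mul, norm_div, norm_pow, norm_pow, Complex.norm_natCast, Complex.norm_real,
    Real.norm_of_nonneg (by linarith)]
  gcongr
  rw [div_le_iff₀ (by positivity), ← mul_pow]
  simpa using norm_binomialMoment_le hpq hR hq n 0 m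

/-- For `r ≥ 1`, arbitrary complex `A, B`, and real `h > 1`,
`∑_{k=0}^{n} C_k(n,h) exp(A(−(1−2k/n)²)^r + B(−(1−2k/n)²)^{2r}) →
exp(A(−h²)^r + B(−h²)^{2r})`. -/
theorem superoscillation_even_power_persistence
    (r : ℕ) (hr : 1 ≤ r) (A B : ℂ) (h : ℝ) (hh : 1 < h) :
    Filter.Tendsto
      (fun n : ℕ => ∑ k ∈ Finset.range (n + 1),
        (supC n k h : ℂ) *
          Complex.exp (A * (-((1 - 2 * k / n : ℝ) : ℂ) ^ 2) ^ r
            + B * (-((1 - 2 * k / n : ℝ) : ℂ) ^ 2) ^ (2 * r)))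
      Filter.atTop
      (nhds (Complex.exp (A * (-(h : ℂ) ^ 2) ^ r + B * (-(h : ℂ) ^ 2) ^ (2 * r)))) := by
  have hf : Differentiable ℂ fun t : ℂ =>
      Complex.exp (A * (-(1 - 2 * t) ^ 2) ^ r + B * (-(1 - 2 * t) ^ 2) ^ (2 * r)) := by
    fun_prop
  have key := tendsto_bernstein_of_entire hf
    (show (1 + (h : ℂ)) / 2 + (1 - (h : ℂ)) / 2 = 1 by ring)
  have e : 1 - 2 * ((1 - (h : ℂ)) / 2) = h := by ring
  simp only [e] at key
  refine key.congr fun n => Finset.sum_congr rfl fun k _ => ?_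
  simp only [supC]
  push_cast
  simp only [mul_div_assoc]
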